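/- Let k ≥ 2 be an integer and let τ be a k-tangle in a graph G. If τ extends to a (k+1)-tangle in G (i.e. there is a (k+1)-tangle τ̃ in G with τ ⊆ τ̃), then for every edge e of G, the tangle τ extends to a k-tangle τ' in G − e. -/

import Mathlib

open Finset

variable {V : Type} [Fintype V] [DecidableEq V]

/-- `{A, B}` is a separation of the graph `G`: the two sides together cover the vertex set and
no edge of `G` joins `A \ B` to `B \ A`. -/
def IsSep (G : SimpleGraph V) (A B : Finset V) : Prop :=
  A ∪ B = Finset.univ ∧ ∀ a ∈ A \ B, ∀ b ∈ B \ A, ¬ G.Adj a b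

/-- `G[A₁] ∪ G[A₂] ∪ G[A₃] = G` for the induced subgraphs on `A₁`, `A₂`, `A₃`. -/
def CoversG (G : SimpleGraph V) (A₁ A₂ A₃ : Finset V) : Prop :=
  (∀ v : V, v ∈ A₁ ∨ v ∈ A₂ ∨ v ∈ A₃) ∧
    ∀ u v : V, G.Adj u v →
      (u ∈ A₁ ∧ v ∈ A₁) ∨ (u ∈ A₂ ∧ v ∈ A₂) ∨ (u ∈ A₃ ∧ v ∈ A₃)

/-- `τ` is a `k`-tangle in `G`: a set of oriented separations of order `< k` containing exactly
one orientation of every separation of order `< k`, and no three of its elements have small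
sides whose induced subgraphs together cover `G`. -/
def IsTangle (G : SimpleGraph V) (k : ℕ) (τ : Set (Finset V × Finset V)) : Prop :=
  (∀ p ∈ τ, IsSep G p.1 p.2 ∧ (p.1 ∩ p.2).card < k) ∧
    (∀ A B : Finset V, IsSep G A B → (A ∩ B).card < k → ((A, B) ∈ τ ↔ (B, A) ∉ τ)) ∧
    ∀ p₁ ∈ τ, ∀ p₂ ∈ τ, ∀ p₃ ∈ τ, ¬ CoversG G p₁.1 p₂.1 p₃.1

/-- `A` together with both of `x` and `y` if `A` contains one of them, and `A` otherwise. -/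
def addEdge (x y : V) (A : Finset V) : Finset V :=
  if x ∈ A ∨ y ∈ A then insert x (insert y A) else A

lemma subset_addEdge (x y : V) (A : Finset V) : A ⊆ addEdge x y A := by
  intro v hv
  unfold addEdge
  split_ifs <;> simp [hv]

lemma mem_addEdge_of_mem {x y : V} {A : Finset V} (h : x ∈ A ∨ y ∈ A) :
    x ∈ addEdge x y A ∧ y ∈ addEdge x y A := by
  simp [addEdge, h]

lemma adj_deleteEdges_or {G : SimpleGraph V} {x y u v : V} (h : G.Adj u v) :
    (G.deleteEdges {s(x, y)}).Adj u v ∨ (u = x ∧ v = y) ∨ (u = y ∧ v = x) := by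
  by_cases h' : s(u, v) = s(x, y)
  · exact Or.inr (by simpa using h')
  · exact Or.inl (by simpa [SimpleGraph.deleteEdges_adj, h] using h')

lemma IsSep.symm {G : SimpleGraph V} {A B : Finset V} (h : IsSep G A B) : IsSep G B A :=
  ⟨by rw [union_comm, h.1], fun a ha b hb hab => h.2 b hb a ha hab.symm⟩

lemma IsSep.mem_or {G : SimpleGraph V} {A B : Finset V} (h : IsSep G A B) (v : V) :
    v ∈ A ∨ v ∈ B := by
  rw [← mem_union, h.1]
  exact mem_univ v

lemma IsSep.adj_mem {G : SimpleGraph V} {A B : Finset V} (h : IsSep G A B) {u v : V}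
    (huv : G.Adj u v) : (u ∈ A ∧ v ∈ A) ∨ (u ∈ B ∧ v ∈ B) := by
  have hu := h.mem_or u
  have hv := h.mem_or v
  have h₁ := h.2 u
  have h₂ := h.2 v
  have hvu := huv.symm
  simp only [mem_sdiff] at h₁ h₂
  grind

/-- Two sides of a separation of `G - xy`, possibly enlarged, cover `G` together with any set that
contains `x` and `y`. -/
lemma IsSep.coversG {G : SimpleGraph V} {x y : V} {A B A' B' C : Finset V}
    (h : IsSep (G.deleteEdges {s(x, y)}) A B) (hA : A ⊆ A') (hB : B ⊆ B')
    (hC : x ∈ C ∧ y ∈ C) : CoversG G A' B' C := by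
  refine ⟨fun v => ?_, fun u v huv => ?_⟩
  · exact (h.mem_or v).imp (@hA v) fun hv => Or.inl (hB hv)
  · rcases adj_deleteEdges_or (x := x) (y := y) huv with h' | ⟨rfl, rfl⟩ | ⟨rfl, rfl⟩
    · rcases h.adj_mem h' with ⟨hu, hv⟩ | ⟨hu, hv⟩
      · exact Or.inl ⟨hA hu, hA hv⟩
      · exact Or.inr (Or.inl ⟨hB hu, hB hv⟩)
    · exact Or.inr (Or.inr hC)
    · exact Or.inr (Or.inr hC.symm)

lemma IsSep.of_deleteEdges_addEdge {G : SimpleGraph V} {x y : V} {A B : Finset V}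
    (h : IsSep (G.deleteEdges {s(x, y)}) A B) : IsSep G (addEdge x y A) B := by
  refine ⟨?_, fun a ha b hb hab => ?_⟩
  · exact eq_univ_of_forall fun v =>
      mem_union.2 ((h.mem_or v).imp_left (@subset_addEdge _ _ _ x y A v))
  · rw [mem_sdiff] at ha hb
    have key := @mem_addEdge_of_mem _ _ _ x y A
    have hsub := @subset_addEdge _ _ _ x y A
    have hx := h.mem_or x
    have hy := h.mem_or y
    rcases adj_deleteEdges_or (x := x) (y := y) hab with h' | ⟨rfl, rfl⟩ | ⟨rfl, rfl⟩
    · rcases h.adj_mem h' with ⟨-, hv⟩ | ⟨hu, -⟩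
      · exact hb.2 (hsub hv)
      · exact ha.2 hu
    all_goals grind

lemma card_addEdge_inter_le (x y : V) (A B : Finset V) :
    (addEdge x y A ∩ B).card ≤ (A ∩ B).card + 1 := by
  have : ∃ z, addEdge x y A ∩ B ⊆ insert z (A ∩ B) := by
    unfold addEdge
    split_ifs with hA
    · rcases hA with hA | hA
      · exact ⟨y, by intro v; simp only [mem_inter, mem_insert]; grind⟩
      · exact ⟨x, by intro v; simp only [mem_inter, mem_insert]; grind⟩
    · exact ⟨x, subset_insert _ _⟩
  obtain ⟨z, hz⟩ := this
  exact (card_le_card hz).trans (card_insert_le _ _)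

lemma IsTangle.pair_mem {G : SimpleGraph V} {k : ℕ} {τ : Set (Finset V × Finset V)}
    (hτ : IsTangle G k τ) (hk : 3 ≤ k) (x y : V) : (({x, y} : Finset V), univ) ∈ τ := by
  have hs : IsSep G ({x, y} : Finset V) univ := ⟨by simp, by simp⟩
  have hc : (({x, y} : Finset V) ∩ univ).card < k := by
    rw [inter_univ]
    exact card_le_two.trans_lt hk
  refine (hτ.2.1 _ _ hs hc).2 fun h => hτ.2.2 _ h _ h _ h ⟨?_, ?_⟩ <;> simp

/-- If a `k`-tangle `τ` (`k ≥ 2`) in `G` extends to a `(k+1)`-tangle in `G`, then for every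
edge `e` of `G`, `τ` extends to a `k`-tangle in `G - e`. -/
theorem stmt12 (k : ℕ) (hk : 2 ≤ k) (G : SimpleGraph V)
    (τ : Set (Finset V × Finset V)) (hτ : IsTangle G k τ)
    (τtilde : Set (Finset V × Finset V)) (hτtilde : IsTangle G (k + 1) τtilde)
    (hsub : τ ⊆ τtilde) (e : Sym2 V) (he : e ∈ G.edgeSet) :
    ∃ τ' : Set (Finset V × Finset V), IsTangle (G.deleteEdges {e}) k τ' ∧ τ ⊆ τ' := by
  induction e using Sym2.ind with | _ x y
  have hxy := hτtilde.pair_mem (by lia) x y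
  have mem_iff {A B : Finset V} (h : IsSep (G.deleteEdges {s(x, y)}) A B)
      (hc : (A ∩ B).card < k) :
      (addEdge x y A, B) ∈ τtilde ↔ (B, addEdge x y A) ∉ τtilde :=
    hτtilde.2.1 _ _ h.of_deleteEdges_addEdge
      ((card_addEdge_inter_le x y A B).trans_lt (by lia))
  refine ⟨{p | IsSep (G.deleteEdges {s(x, y)}) p.1 p.2 ∧ (p.1 ∩ p.2).card < k ∧
    (addEdge x y p.1, p.2) ∈ τtilde}, ⟨fun p hp => ⟨hp.1, hp.2.1⟩, fun A B h hc => ?_, ?_⟩, ?_⟩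
  · have hc' : (B ∩ A).card < k := by rwa [inter_comm]
    constructor
    · rintro ⟨-, -, hA⟩ ⟨-, -, hB⟩
      rcases h.mem_or x with hx | hx
      · exact hτtilde.2.2 _ hA _ hB _ hA
          (h.coversG (subset_addEdge x y A) (subset_addEdge x y B)
            (mem_addEdge_of_mem (Or.inl hx)))
      · exact hτtilde.2.2 _ hA _ hB _ hB
          (h.coversG (subset_addEdge x y A) (subset_addEdge x y B)
            (mem_addEdge_of_mem (Or.inl hx)))
    · intro hB
      refine ⟨h, hc, (mem_iff h hc).2 fun hBA => hB ⟨h.symm, hc', ?_⟩⟩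
      exact (mem_iff h.symm hc').2 fun hAB => hτtilde.2.2 _ hAB _ hBA _ hxy
        (h.coversG Subset.rfl Subset.rfl (by simp))
  · rintro p₁ ⟨-, -, h₁⟩ p₂ ⟨-, -, h₂⟩ p₃ ⟨-, -, h₃⟩ ⟨hv, he'⟩
    have s₁ := @subset_addEdge _ _ _ x y p₁.1
    have s₂ := @subset_addEdge _ _ _ x y p₂.1
    have s₃ := @subset_addEdge _ _ _ x y p₃.1
    have hx := (hv x).imp (fun h => mem_addEdge_of_mem (y := y) (Or.inl h))
      (Or.imp (fun h => mem_addEdge_of_mem (y := y) (Or.inl h))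
        (fun h => mem_addEdge_of_mem (y := y) (Or.inl h)))
    refine hτtilde.2.2 _ h₁ _ h₂ _ h₃
      ⟨fun v => (hv v).imp (@s₁ v) (Or.imp (@s₂ v) (@s₃ v)), fun u v huv => ?_⟩
    rcases adj_deleteEdges_or (x := x) (y := y) huv with h' | ⟨rfl, rfl⟩ | ⟨rfl, rfl⟩
    · exact (he' u v h').imp (And.imp (@s₁ u) (@s₁ v))
        (Or.imp (And.imp (@s₂ u) (@s₂ v)) (And.imp (@s₃ u) (@s₃ v)))
    · exact hx
    · exact hx.imp And.symm (Or.imp And.symm And.symm)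
  · intro p hp
    obtain ⟨h, hc⟩ := hτ.1 p hp
    have h' : IsSep (G.deleteEdges {s(x, y)}) p.1 p.2 :=
      ⟨h.1, fun a ha b hb hab => h.2 a ha b hb (SimpleGraph.deleteEdges_le _ hab)⟩
    exact ⟨h', hc, (mem_iff h' hc).2 fun hB => hτtilde.2.2 _ (hsub hp) _ hB _ hxy
      (h'.coversG Subset.rfl Subset.rfl (by simp))⟩
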